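/- arXiv:math/0103096 — 5 statements merged into one kernel-verified Lean document; each statement's English description precedes it below -/
import Mathlib

section
/- Let n ≥ 1 be a natural number, let λ, δ, e be real numbers, and set β = (n+1)(1−δ). Let m be a natural number and assume 2e + β − 1 + j ≠ 0 for every integer j with 0 ≤ j ≤ 2m−1. Then the m-th coefficient of the hypergeometric series F(A₁,A₂;B₁,B₂|z) with parameters A₁ = e+(n+1)λ, A₂ = 2e+β−1, B₁ = e+(β−1)/2, B₂ = e+β/2, evaluated with the extra factor 4^{−m} coming from the variable Z = z/4, equals the quantization coefficient C_m(e); explicitly, ((e+(n+1)λ)_m · (2e+β−1)_m) / (4^m · m! · (e+(β−1)/2)_m · (e+β/2)_m) = (e+(n+1)λ)_m / (m! · (2e+β+m−1)_m). -/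
/-- The Pochhammer symbol `(a)_m = a (a+1) ⋯ (a+m-1)` for a real number `a`. -/
noncomputable def poch (a : ℝ) (m : ℕ) : ℝ := ∏ j ∈ Finset.range m, (a + j)

theorem poch_add (a : ℝ) (k m : ℕ) : poch a (k + m) = poch a k * poch (a + k) m := by
  unfold poch
  rw [Finset.prod_range_add]
  congr 1
  apply Finset.prod_congr rfl
  intro j _
  push_cast
  ring

theorem poch_double (a : ℝ) (m : ℕ) :
    poch a (2 * m) = 4 ^ m * poch (a / 2) m * poch ((a + 1) / 2) m := by
  unfold poch
  induction m with
  | zero => simp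
  | succ k ih =>
    rw [show 2 * (k + 1) = 2 * k + 1 + 1 by ring, Finset.prod_range_succ, Finset.prod_range_succ,
      ih, Finset.prod_range_succ, Finset.prod_range_succ]
    push_cast
    ring

/-- Coefficientwise content of Theorem 3.1: the `m`-th coefficient of the
hypergeometric series `F(A₁,A₂;B₁,B₂|z)` with `A₁ = e+(n+1)λ`, `A₂ = 2e+β-1`,
`B₁ = e+(β-1)/2`, `B₂ = e+β/2` (where `β = (n+1)(1-δ)`), including the factor
`4^{-m}` from `Z = z/4`, equals the quantization coefficient `C_m(e)`. -/
theorem quantization_coeff_hypergeometric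
    (n : ℕ) (hn : 1 ≤ n) (lam δ e : ℝ) (β : ℝ) (hβ : β = ((n : ℝ) + 1) * (1 - δ))
    (m : ℕ) (hden : ∀ j : ℕ, j < 2 * m → 2 * e + β - 1 + (j : ℝ) ≠ 0) :
    (poch (e + ((n : ℝ) + 1) * lam) m * poch (2 * e + β - 1) m) /
      ((4 : ℝ) ^ m * (Nat.factorial m : ℝ) * poch (e + (β - 1) / 2) m *
        poch (e + β / 2) m)
    = poch (e + ((n : ℝ) + 1) * lam) m /
        ((Nat.factorial m : ℝ) * poch (2 * e + β + (m : ℝ) - 1) m) := by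
  have h1 := poch_add (2 * e + β - 1) m m
  have h2 := poch_double (2 * e + β - 1) m
  have h0 : poch (2 * e + β - 1) (2 * m) ≠ 0 := by
    unfold poch
    exact Finset.prod_ne_zero_iff.mpr fun j hj => hden j (Finset.mem_range.mp hj)
  rw [← two_mul] at h1
  rw [show (2 * e + β - 1) / 2 = e + (β - 1) / 2 by ring,
    show (2 * e + β - 1 + 1) / 2 = e + β / 2 by ring] at h2
  rw [show 2 * e + β - 1 + (m : ℝ) = 2 * e + β + (m : ℝ) - 1 by ring] at h1
  have h3 := h0
  rw [h1] at h3
  have hA := left_ne_zero_of_mul h3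
  have hB := right_ne_zero_of_mul h3
  have hf : (Nat.factorial m : ℝ) ≠ 0 := by exact_mod_cast Nat.factorial_ne_zero m
  have h4 : (4 : ℝ) ^ m * (Nat.factorial m : ℝ) * poch (e + (β - 1) / 2) m * poch (e + β / 2) m
      = (Nat.factorial m : ℝ) * (poch (2 * e + β - 1) m * poch (2 * e + β + (m : ℝ) - 1) m) := by
    rw [← h1, h2]
    ring
  rw [h4]
  generalize poch (2 * e + β - 1) m = A at *
  generalize poch (2 * e + β + (m : ℝ) - 1) m = B at *
  generalize poch (e + ((n : ℝ) + 1) * lam) m = C at *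
  field_simp
end

section
/- Let n ≥ 1 be a natural number, let λ, δ be real numbers, set β = (n+1)(1−δ), and let k be a natural number. Assume 2k − m' − 2 + β ≠ 0 for every natural number m' with 0 ≤ m' ≤ k−1. Let C : ℕ → ℝ satisfy C(0) = 1 and, for every m with 0 ≤ m ≤ k−1, C(m+1) = ((k−m−1+(n+1)λ) / ((m+1)(2k−m−2+β))) · C(m). Then for every m with 0 ≤ m ≤ k, C(m) = (1/m!) · (k−m+(n+1)λ)_m / (2(k−m)+β+m−1)_m. -/
/-- The recursion (2.6) for the coefficients `C_m^k` of the projectively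
equivariant quantization map, with normalization `C_0^k = 1`, has the closed
form solution `C_m = (1/m!) (k-m+(n+1)λ)_m / (2(k-m)+β+m-1)_m`
where `β = (n+1)(1-δ)` (formula (3.10) with the Euler operator evaluated at `k-m`). -/
theorem quantization_coeff_recursion_closed_form
    (n : ℕ) (hn : 1 ≤ n) (lam δ : ℝ) (β : ℝ) (hβ : β = ((n : ℝ) + 1) * (1 - δ))
    (k : ℕ) (hden : ∀ m' : ℕ, m' < k → 2 * (k : ℝ) - (m' : ℝ) - 2 + β ≠ 0)
    (C : ℕ → ℝ) (hC0 : C 0 = 1)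
    (hrec : ∀ m : ℕ, m < k →
      C (m + 1) = (((k : ℝ) - (m : ℝ) - 1 + ((n : ℝ) + 1) * lam) /
        (((m : ℝ) + 1) * (2 * (k : ℝ) - (m : ℝ) - 2 + β))) * C m) :
    ∀ m : ℕ, m ≤ k →
      C m = (1 / (Nat.factorial m : ℝ)) *
        poch (((k : ℝ) - (m : ℝ)) + ((n : ℝ) + 1) * lam) m /
        poch (2 * ((k : ℝ) - (m : ℝ)) + β + (m : ℝ) - 1) m := by
  have hp : ∀ (a : ℝ) (m : ℕ), poch a (m + 1) = a * poch (a + 1) m := by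
    intro a m
    unfold poch
    rw [Finset.prod_range_succ', mul_comm]
    congr 1
    · simp
    · refine Finset.prod_congr rfl fun j _ => ?_
      push_cast
      ring
  intro m
  induction m with
  | zero => intro _; simp [poch, hC0]
  | succ m ih =>
    intro hm
    rw [hrec m hm, ih (by omega), hp, hp, Nat.factorial_succ]
    push_cast
    have e1 : (k : ℝ) - (m + 1) + (n + 1) * lam + 1 = k - m + (n + 1) * lam := by ring
    have e2 : 2 * ((k : ℝ) - (m + 1)) + β + (m + 1) - 1 + 1
        = 2 * (k - m) + β + m - 1 := by ring
    have e3 : 2 * ((k : ℝ) - (m + 1)) + β + (m + 1) - 1 = 2 * k - m - 2 + β := by ring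
    have e4 : (k : ℝ) - (m + 1) + (n + 1) * lam = k - m - 1 + (n + 1) * lam := by ring
    rw [e1, e2, e3, e4]
    generalize poch _ m = P
    generalize poch _ m = Q
    simp only [div_eq_mul_inv, mul_inv]
    generalize (2 * (k : ℝ) - m - 2 + β)⁻¹ = A
    generalize ((m : ℝ) + 1)⁻¹ = B
    ring
end

section
/- Let n ≥ 1 be a natural number, let λ, δ be real numbers, and set β = (n+1)(1−δ). Let C̃ : ℕ × ℕ → ℝ (written C̃_m^k) satisfy C̃_0^k = 1 for every k, and C̃_{m+1}^{k+1} = −((k+(n+1)λ) / ((m+1)(2k−m+β))) · C̃_m^k whenever 2k−m+β ≠ 0. Fix k and m with 0 ≤ m ≤ k and assume 2(k−m) + β + j ≠ 0 for every integer j with 0 ≤ j ≤ m−1. Then C̃_m^k = ((−1)^m / m!) · (k−m+(n+1)λ)_m / (2(k−m)+β)_m. -/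
/-- The recursion (2.8) for the coefficients `C̃_m^k` of the projectively
equivariant symbol map, with normalization `C̃_0^k = 1`, has the closed form
solution `C̃_m^k = ((-1)^m/m!) (k-m+(n+1)λ)_m / (2(k-m)+β)_m`
where `β = (n+1)(1-δ)` (coefficientwise content of Theorem 3.5). -/
theorem symbol_coeff_recursion_closed_form
    (n : ℕ) (hn : 1 ≤ n) (lam δ : ℝ) (β : ℝ) (hβ : β = ((n : ℝ) + 1) * (1 - δ))
    (Ct : ℕ → ℕ → ℝ) (hC0 : ∀ k : ℕ, Ct 0 k = 1)
    (hrec : ∀ m k : ℕ, 2 * (k : ℝ) - (m : ℝ) + β ≠ 0 →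
      Ct (m + 1) (k + 1) = -(((k : ℝ) + ((n : ℝ) + 1) * lam) /
        (((m : ℝ) + 1) * (2 * (k : ℝ) - (m : ℝ) + β))) * Ct m k)
    (k m : ℕ) (hmk : m ≤ k)
    (hden : ∀ j : ℕ, j < m → 2 * ((k : ℝ) - (m : ℝ)) + β + (j : ℝ) ≠ 0) :
    Ct m k = ((-1 : ℝ) ^ m / (Nat.factorial m : ℝ)) *
      poch (((k : ℝ) - (m : ℝ)) + ((n : ℝ) + 1) * lam) m /
      poch (2 * ((k : ℝ) - (m : ℝ)) + β) m := by
  induction m generalizing k with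
  | zero => simp [hC0, poch]
  | succ m ih =>
    obtain ⟨k, rfl⟩ : ∃ k', k = k' + 1 := ⟨k - 1, by omega⟩
    have e : ((k + 1 : ℕ) : ℝ) - ((m + 1 : ℕ) : ℝ) = (k : ℝ) - m := by push_cast; ring
    rw [e] at hden ⊢
    have hm := hden m (Nat.lt_succ_self m)
    have e2 : 2 * (k : ℝ) - (m : ℝ) + β = 2 * ((k : ℝ) - m) + β + m := by ring
    have e3 : (k : ℝ) - m + ((n : ℝ) + 1) * lam + m = k + ((n : ℝ) + 1) * lam := by ring
    have hp : ∀ a : ℝ, poch a (m + 1) = poch a m * (a + m) := fun a => by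
      simp [poch, Finset.prod_range_succ]
    rw [hrec m k (by rw [e2]; exact hm),
      ih k (by omega) (fun j hj => hden j (by omega)), hp, hp, e2, e3, Nat.factorial_succ,
      pow_succ]
    push_cast
    simp only [div_eq_mul_inv, mul_inv]
    ring
end

section
/- Let n ≥ 1 and define H : ℝⁿ × ℝⁿ → ℝ by H(x,ξ) = (1+‖x‖²)(‖ξ‖² + ⟨x,ξ⟩²). Let α be a real number. Then at every point (x,ξ) with ξ ≠ 0 (so that H(x,ξ) > 0), the function H^α is smooth and Σ_{i=1}^{n} ∂²(H^α)/∂x^i∂ξ^i = 2α(4α+n−1) · H^{α−1} · (1+‖x‖²) · ⟨x,ξ⟩. -/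
open Function

/-- The divergence operator `D = Σ_i ∂²/∂x^i∂ξ^i` (formula (2.3)) acting on a
symbol `f(x,ξ)` on `T*ℝⁿ`. -/
noncomputable def divOp (n : ℕ) (f : (Fin n → ℝ) → (Fin n → ℝ) → ℝ)
    (x ξ : Fin n → ℝ) : ℝ :=
  ∑ i : Fin n,
    deriv (fun t : ℝ =>
      deriv (fun s : ℝ => f (Function.update x i t) (Function.update ξ i s)) (ξ i)) (x i)

/-- The quadratic Hamiltonian of the geodesic flow of the round metric on the
unit `n`-sphere in an affine chart (formula (4.1)):
`H(x,ξ) = (1+‖x‖²)(‖ξ‖² + ⟨x,ξ⟩²)`. -/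
noncomputable def geoHam (n : ℕ) (x ξ : Fin n → ℝ) : ℝ :=
  (1 + ∑ i : Fin n, (x i) ^ 2) *
    ((∑ i : Fin n, (ξ i) ^ 2) + (∑ i : Fin n, x i * ξ i) ^ 2)

lemma geoHam_pos (n : ℕ) (x ξ : Fin n → ℝ) (hξ : ξ ≠ 0) : 0 < geoHam n x ξ := by
  unfold geoHam
  obtain ⟨i, hi⟩ := Function.ne_iff.mp hξ
  have h1 : 0 < ∑ i : Fin n, (ξ i) ^ 2 :=
    Finset.sum_pos' (fun j _ => sq_nonneg _) ⟨i, Finset.mem_univ _, by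
      have : ξ i ≠ 0 := hi
      positivity⟩
  have h2 : 0 ≤ ∑ i : Fin n, (x i) ^ 2 := Finset.sum_nonneg (fun j _ => sq_nonneg _)
  positivity

lemma sum_update_aux (n : ℕ) (g : ℝ → ℝ → ℝ) (x ξ : Fin n → ℝ) (i : Fin n) (t s : ℝ) :
    ∑ j, g (Function.update x i t j) (Function.update ξ i s j)
      = (∑ j, g (x j) (ξ j)) - g (x i) (ξ i) + g t s := by
  rw [← Finset.add_sum_erase _ _ (Finset.mem_univ i),
    ← Finset.add_sum_erase (Finset.univ) (fun j => g (x j) (ξ j)) (Finset.mem_univ i)]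
  have : ∑ j ∈ Finset.univ.erase i, g (Function.update x i t j) (Function.update ξ i s j)
      = ∑ j ∈ Finset.univ.erase i, g (x j) (ξ j) := by
    apply Finset.sum_congr rfl
    intro j hj
    have hj' := Finset.ne_of_mem_erase hj
    simp [Function.update_of_ne hj']
  rw [this]
  simp
  ring

lemma geoHam_update (n : ℕ) (x ξ : Fin n → ℝ) (i : Fin n) (t s : ℝ) :
    geoHam n (Function.update x i t) (Function.update ξ i s) =
      (1 + ((∑ j, (x j) ^ 2) - (x i) ^ 2 + t ^ 2)) *
        (((∑ j, (ξ j) ^ 2) - (ξ i) ^ 2 + s ^ 2) +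
          ((∑ j, x j * ξ j) - x i * ξ i + t * s) ^ 2) := by
  unfold geoHam
  rw [sum_update_aux n (fun a _ => a ^ 2) x ξ i t s, sum_update_aux n (fun _ b => b ^ 2) x ξ i t s,
    sum_update_aux n (fun a b => a * b) x ξ i t s]

lemma term_deriv (n : ℕ) (α : ℝ) (x ξ : Fin n → ℝ) (hξ : ξ ≠ 0) (i : Fin n) :
    deriv (fun t : ℝ => deriv (fun s : ℝ =>
      geoHam n (Function.update x i t) (Function.update ξ i s) ^ α) (ξ i)) (x i) =
    α * (α - 1) * geoHam n x ξ ^ (α - 1 - 1) *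
      ((2 * x i * ((∑ j, (ξ j) ^ 2) + (∑ j, x j * ξ j) ^ 2)
        + (1 + ∑ j, (x j) ^ 2) * (2 * (∑ j, x j * ξ j) * ξ i)) *
       ((1 + ∑ j, (x j) ^ 2) * (2 * ξ i + 2 * (∑ j, x j * ξ j) * x i)))
    + α * geoHam n x ξ ^ (α - 1) *
      (2 * x i * (2 * ξ i + 2 * (∑ j, x j * ξ j) * x i)
        + (1 + ∑ j, (x j) ^ 2) * (2 * ξ i * x i + 2 * (∑ j, x j * ξ j))) := by
  have hpos : ∀ t, 0 < geoHam n (Function.update x i t) ξ := fun t => geoHam_pos n _ ξ hξ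
  have hup : ∀ t, geoHam n (Function.update x i t) ξ =
      (1 + ((∑ j, (x j) ^ 2) - (x i) ^ 2 + t ^ 2)) *
        (((∑ j, (ξ j) ^ 2) - (ξ i) ^ 2 + (ξ i) ^ 2) +
          ((∑ j, x j * ξ j) - x i * ξ i + t * ξ i) ^ 2) := fun t => by
    have := geoHam_update n x ξ i t (ξ i)
    rwa [Function.update_eq_self] at this
  have hx := hpos (x i)
  rw [hup] at hx
  have hH : geoHam n x ξ = (1 + ∑ j, (x j) ^ 2) *
    ((∑ j, (ξ j) ^ 2) + (∑ j, x j * ξ j) ^ 2) := rfl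
  set X := ∑ j, (x j) ^ 2
  set Y := ∑ j, (ξ j) ^ 2
  set P := ∑ j, x j * ξ j
  have hin : ∀ t, deriv (fun s : ℝ =>
      geoHam n (Function.update x i t) (Function.update ξ i s) ^ α) (ξ i) =
      ((1 + (X - x i ^ 2 + t ^ 2)) *
        (2 * ξ i + 2 * (P - x i * ξ i + t * ξ i) * t)) * α *
      ((1 + (X - (x i) ^ 2 + t ^ 2)) *
        ((Y - (ξ i) ^ 2 + (ξ i) ^ 2) + (P - x i * ξ i + t * ξ i) ^ 2)) ^ (α - 1) := by
    intro t
    simp only [geoHam_update]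
    have hid := hasDerivAt_id' (ξ i)
    have h1 := (((hid.pow 2).const_add (Y - ξ i ^ 2)).add
      (((hid.const_mul t).const_add (P - x i * ξ i)).pow 2)).const_mul (1 + (X - x i ^ 2 + t ^ 2))
    have hp := hpos t
    rw [hup] at hp
    have h2 := h1.rpow_const (p := α) (Or.inl hp.ne')
    refine Eq.trans h2.deriv ?_
    simp
  simp only [hin]
  have hid := hasDerivAt_id' (x i)
  have hA := ((hid.pow 2).const_add (X - x i ^ 2)).const_add 1
  have hp := (hid.mul_const (ξ i)).const_add (P - x i * ξ i)
  have hB := (hp.pow 2).const_add (Y - ξ i ^ 2 + ξ i ^ 2)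
  have hR := (hA.mul hB).rpow_const (p := α - 1) (Or.inl hx.ne')
  have hC := hA.mul (((hp.const_mul 2).mul hid).const_add (2 * ξ i))
  have hT := (hC.mul_const α).mul hR
  refine Eq.trans hT.deriv ?_
  rw [hH]
  simp
  ring

/-- Key computation in the proof of Proposition 4.3: at every point with
`ξ ≠ 0` the symbol `H^α` is smooth and
`D(H^α) = 2α(4α+n-1) H^{α-1} (1+‖x‖²) ⟨x,ξ⟩`. -/
theorem div_geoHam_rpow
    (n : ℕ) (hn : 1 ≤ n) (α : ℝ) (x ξ : Fin n → ℝ) (hξ : ξ ≠ 0) :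
    ContDiffAt ℝ (⊤ : ℕ∞)
      (fun p : (Fin n → ℝ) × (Fin n → ℝ) => geoHam n p.1 p.2 ^ α) (x, ξ) ∧
    divOp n (fun x ξ => geoHam n x ξ ^ α) x ξ =
      2 * α * (4 * α + (n : ℝ) - 1) * geoHam n x ξ ^ (α - 1) *
        (1 + ∑ i : Fin n, (x i) ^ 2) * (∑ i : Fin n, x i * ξ i) := by
  have hpos := geoHam_pos n x ξ hξ
  constructor
  · refine ContDiffAt.rpow_const_of_ne (f := fun p : (Fin n → ℝ) × (Fin n → ℝ) => geoHam n p.1 p.2)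
      ?_ hpos.ne'
    unfold geoHam
    fun_prop
  · unfold divOp
    rw [Finset.sum_congr rfl (fun i _ => term_deriv n α x ξ hξ i)]
    rw [Finset.sum_add_distrib, ← Finset.mul_sum, ← Finset.mul_sum]
    have hr : geoHam n x ξ ^ (α - 1) = geoHam n x ξ ^ (α - 1 - 1) * geoHam n x ξ := by
      rw [← Real.rpow_add_one hpos.ne']
      ring_nf
    have hHd : geoHam n x ξ = (1 + ∑ i : Fin n, (x i) ^ 2) *
      ((∑ i : Fin n, (ξ i) ^ 2) + (∑ i : Fin n, x i * ξ i) ^ 2) := rfl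
    set X := ∑ j, (x j) ^ 2 with hX
    set Y := ∑ j, (ξ j) ^ 2 with hY
    set P := ∑ j, x j * ξ j with hP
    have e1 : ∑ i, ((2 * x i * (Y + P ^ 2) + (1 + X) * (2 * P * ξ i)) *
       ((1 + X) * (2 * ξ i + 2 * P * x i))) = 8 * (1 + X) * P * ((1 + X) * (Y + P ^ 2)) := by
      have : ∀ i, (2 * x i * (Y + P ^ 2) + (1 + X) * (2 * P * ξ i)) *
          ((1 + X) * (2 * ξ i + 2 * P * x i)) =
          (4 * (Y + P ^ 2) * (1 + X) + 4 * (1 + X) ^ 2 * P ^ 2) * (x i * ξ i)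
          + 4 * (Y + P ^ 2) * (1 + X) * P * (x i) ^ 2
          + 4 * (1 + X) ^ 2 * P * (ξ i) ^ 2 := fun i => by ring
      simp only [this, Finset.sum_add_distrib, ← Finset.mul_sum]
      rw [← hX, ← hY, ← hP]
      ring
    have e2 : ∑ i, (2 * x i * (2 * ξ i + 2 * P * x i)
        + (1 + X) * (2 * ξ i * x i + 2 * P)) = (1 + X) * P * (6 + 2 * n) := by
      have : ∀ i, 2 * x i * (2 * ξ i + 2 * P * x i) + (1 + X) * (2 * ξ i * x i + 2 * P) =
          (4 + 2 * (1 + X)) * (x i * ξ i) + 4 * P * (x i) ^ 2 + (1 + X) * (2 * P) :=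
        fun i => by ring
      simp only [this, Finset.sum_add_distrib, ← Finset.mul_sum]
      rw [← hX, ← hP]
      simp
      ring
    rw [e1, e2, ← hHd, hr]
    ring
end

section
/- Let n ≥ 1 and define H : ℝⁿ × ℝⁿ → ℝ by H(x,ξ) = (1+‖x‖²)(‖ξ‖² + ⟨x,ξ⟩²). Set α = (1−n)/4. Then at every point (x,ξ) with ξ ≠ 0, Σ_{i=1}^{n} ∂²(H^α)/∂x^i∂ξ^i = 0; that is, the pseudo-differential symbol H^{(1−n)/4} is annihilated by the divergence operator D. -/
open Function

theorem aux_sum_update (n : ℕ) (F : ℝ → ℝ → ℝ) (x ξ : Fin n → ℝ) (i : Fin n) (t s : ℝ) :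
    ∑ j, F (Function.update x i t j) (Function.update ξ i s j)
      = (∑ j, F (x j) (ξ j)) - F (x i) (ξ i) + F t s := by
  rw [← Finset.add_sum_erase Finset.univ _ (Finset.mem_univ i),
    ← Finset.add_sum_erase Finset.univ (fun j => F (x j) (ξ j)) (Finset.mem_univ i)]
  have : ∑ j ∈ Finset.univ.erase i, F (Function.update x i t j) (Function.update ξ i s j)
      = ∑ j ∈ Finset.univ.erase i, F (x j) (ξ j) := by
    apply Finset.sum_congr rfl
    intro j hj
    have hji : j ≠ i := Finset.ne_of_mem_erase hj
    simp [Function.update_of_ne hji]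
  rw [this]
  simp
  ring

theorem aux_geoHam_update (n : ℕ) (x ξ : Fin n → ℝ) (i : Fin n) (t s : ℝ) :
    geoHam n (Function.update x i t) (Function.update ξ i s)
      = (1 + ((∑ j, x j ^ 2) - x i ^ 2 + t ^ 2)) *
        (((∑ j, ξ j ^ 2) - ξ i ^ 2 + s ^ 2) + ((∑ j, x j * ξ j) - x i * ξ i + t * s) ^ 2) := by
  unfold geoHam
  rw [aux_sum_update n (fun a _ => a ^ 2) x ξ i t s, aux_sum_update n (fun _ b => b ^ 2) x ξ i t s,
    aux_sum_update n (fun a b => a * b) x ξ i t s]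

theorem aux_calc (α a b c x0 y0 : ℝ) (ha : 0 ≤ a) (hb : 0 < b + y0 ^ 2) :
    deriv (fun t : ℝ => deriv (fun s : ℝ =>
      ((1 + (a + t ^ 2)) * ((b + s ^ 2) + (c + t * s) ^ 2)) ^ α) y0) x0
    = (2 * x0 * (2 * y0 + 2 * (c + x0 * y0) * x0)
        + (1 + (a + x0 ^ 2)) * (2 * y0 * x0 + 2 * (c + x0 * y0))) * α *
        ((1 + (a + x0 ^ 2)) * ((b + y0 ^ 2) + (c + x0 * y0) ^ 2)) ^ (α - 1)
      + ((1 + (a + x0 ^ 2)) * (2 * y0 + 2 * (c + x0 * y0) * x0)) * α *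
        ((2 * x0 * ((b + y0 ^ 2) + (c + x0 * y0) ^ 2)
          + (1 + (a + x0 ^ 2)) * (2 * (c + x0 * y0) * y0)) * (α - 1) *
        ((1 + (a + x0 ^ 2)) * ((b + y0 ^ 2) + (c + x0 * y0) ^ 2)) ^ (α - 1 - 1)) := by
  have hpos : ∀ t : ℝ, (1 + (a + t ^ 2)) * ((b + y0 ^ 2) + (c + t * y0) ^ 2) ≠ 0 := by
    intro t
    have h1 : 0 < 1 + (a + t ^ 2) := by positivity
    have h2 : 0 < (b + y0 ^ 2) + (c + t * y0) ^ 2 := by positivity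
    exact (mul_pos h1 h2).ne'
  have hin : (fun t : ℝ => deriv (fun s : ℝ =>
      ((1 + (a + t ^ 2)) * ((b + s ^ 2) + (c + t * s) ^ 2)) ^ α) y0)
      = fun t => ((1 + (a + t ^ 2)) * (2 * y0 + 2 * (c + t * y0) * t)) * α *
        ((1 + (a + t ^ 2)) * ((b + y0 ^ 2) + (c + t * y0) ^ 2)) ^ (α - 1) := by
    funext t
    have h1 : HasDerivAt (fun s : ℝ => c + t * s) t y0 := by
      simpa using ((hasDerivAt_id y0).const_mul t).const_add c
    have h2 : HasDerivAt (fun s : ℝ => b + s ^ 2) (2 * y0) y0 := by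
      simpa using (hasDerivAt_pow 2 y0).const_add b
    have h3 := (h2.add (h1.pow 2)).const_mul (1 + (a + t ^ 2))
    have h4 := h3.rpow_const (p := α) (Or.inl (hpos t))
    refine h4.deriv.trans ?_
    simp
  rw [hin]
  have h1 : HasDerivAt (fun t : ℝ => c + t * y0) y0 x0 := by
    simpa using ((hasDerivAt_id x0).mul_const y0).const_add c
  have h2 : HasDerivAt (fun t : ℝ => 1 + (a + t ^ 2)) (2 * x0) x0 := by
    simpa using ((hasDerivAt_pow 2 x0).const_add a).const_add 1
  have h3 := h2.mul ((h1.pow 2).const_add (b + y0 ^ 2))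
  have h4 := h3.rpow_const (p := α - 1) (Or.inl (hpos x0))
  have h5 := ((h2.mul (((h1.const_mul 2).mul (hasDerivAt_id x0)).const_add (2 * y0))).mul_const
    α).mul h4
  refine h5.deriv.trans ?_
  simp

theorem div_geoHam_rpow_special_exponent
    (n : ℕ) (hn : 1 ≤ n) (α : ℝ) (hα : α = (1 - (n : ℝ)) / 4)
    (x ξ : Fin n → ℝ) (hξ : ξ ≠ 0) :
    divOp n (fun x ξ => geoHam n x ξ ^ α) x ξ = 0 := by
  unfold divOp
  have hb : 0 < ∑ j, ξ j ^ 2 := by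
    obtain ⟨k, hk⟩ := Function.ne_iff.mp hξ
    exact Finset.sum_pos' (fun j _ => sq_nonneg _) ⟨k, Finset.mem_univ k, by
      have : ξ k ≠ 0 := hk
      positivity⟩
  simp only [aux_geoHam_update]
  have key : ∀ i, _ := fun i : Fin n => aux_calc α ((∑ j, x j ^ 2) - x i ^ 2)
    ((∑ j, ξ j ^ 2) - ξ i ^ 2) ((∑ j, x j * ξ j) - x i * ξ i) (x i) (ξ i)
    (sub_nonneg.mpr (Finset.single_le_sum (f := fun j => x j ^ 2)
      (fun j _ => sq_nonneg _) (Finset.mem_univ i))) (by simpa using hb)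
  rw [Finset.sum_congr rfl (fun i _ => key i)]
  simp only [sub_add_cancel]
  have hX : 0 ≤ ∑ j, x j ^ 2 := Finset.sum_nonneg (fun j _ => sq_nonneg _)
  obtain ⟨X, hXd⟩ : ∃ X, X = ∑ j, x j ^ 2 := ⟨_, rfl⟩
  obtain ⟨Y, hYd⟩ : ∃ Y, Y = ∑ j, ξ j ^ 2 := ⟨_, rfl⟩
  obtain ⟨p, hpd⟩ : ∃ p, p = ∑ j, x j * ξ j := ⟨_, rfl⟩
  rw [← hXd] at hX
  rw [← hYd] at hb
  simp only [← hXd, ← hYd, ← hpd]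
  have hH : 0 < (1 + X) * (Y + p ^ 2) := by positivity
  have hpw : ((1 + X) * (Y + p ^ 2)) ^ (α - 1)
      = ((1 + X) * (Y + p ^ 2)) ^ (α - 1 - 1) * ((1 + X) * (Y + p ^ 2)) := by
    conv_rhs => rw [← Real.rpow_add_one hH.ne', sub_add_cancel]
  rw [hpw]
  generalize ((1 + X) * (Y + p ^ 2)) ^ (α - 1 - 1) = R
  have e : ∀ i, (2 * x i * (2 * ξ i + 2 * p * x i) + (1 + X) * (2 * ξ i * x i + 2 * p)) * α *
        (R * ((1 + X) * (Y + p ^ 2))) +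
      (1 + X) * (2 * ξ i + 2 * p * x i) * α *
        ((2 * x i * (Y + p ^ 2) + (1 + X) * (2 * p * ξ i)) * (α - 1) * R)
      = ((4 + 2 * (1 + X)) * α * (R * ((1 + X) * (Y + p ^ 2)))
          + 4 * (1 + X) * α * (α - 1) * R * ((Y + p ^ 2) + (1 + X) * p ^ 2)) * (x i * ξ i)
        + (4 * p * α * (R * ((1 + X) * (Y + p ^ 2)))
          + 4 * (1 + X) * α * (α - 1) * R * p * (Y + p ^ 2)) * x i ^ 2
        + 4 * (1 + X) ^ 2 * α * (α - 1) * R * p * ξ i ^ 2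
        + 2 * (1 + X) * p * α * (R * ((1 + X) * (Y + p ^ 2))) := by
    intro i; ring
  rw [Finset.sum_congr rfl (fun i _ => e i)]
  simp only [Finset.sum_add_distrib, ← Finset.mul_sum, ← hXd, ← hYd, ← hpd, Finset.sum_const,
    Finset.card_univ, Fintype.card_fin, nsmul_eq_mul]
  have hn' : (n : ℝ) = 1 - 4 * α := by rw [hα]; ring
  rw [hn']
  ring
end
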